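/- Let κ be a measurable cardinal and U a κ-complete nonprincipal ultrafilter on κ. Then the tree Prikry forcing ℙ on κ, equipped with the length function l(p) = lh(s_p), is κ-geometric. -/

import Mathlib

/-- A condition of the tree Prikry forcing on `κ`: a finite sequence (stem) `s`
of ordinals and a tree `T` of finite sequences of ordinals. -/
structure TCond : Type 1 where
  s : List Ordinal.{0}
  T : Set (List Ordinal.{0})

/-- `U` is an ultrafilter on (the subsets of) `Set.Iio κ.ord`, i.e. on κ. -/
def IsUltrafilterOn (κ : Cardinal.{0}) (U : Set (Set Ordinal.{0})) : Prop :=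
  (∀ A ∈ U, A ⊆ Set.Iio κ.ord) ∧
  Set.Iio κ.ord ∈ U ∧
  (∅ : Set Ordinal.{0}) ∉ U ∧
  (∀ A B : Set Ordinal.{0}, A ∈ U → A ⊆ B → B ⊆ Set.Iio κ.ord → B ∈ U) ∧
  (∀ A B : Set Ordinal.{0}, A ∈ U → B ∈ U → A ∩ B ∈ U) ∧
  (∀ A : Set Ordinal.{0}, A ⊆ Set.Iio κ.ord → A ∈ U ∨ Set.Iio κ.ord \ A ∈ U)

/-- `U` is κ-complete: the intersection of fewer than κ members of `U`
(here: a family indexed by an ordinal `γ < κ`) is in `U`. -/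
def IsKappaComplete (κ : Cardinal.{0}) (U : Set (Set Ordinal.{0})) : Prop :=
  ∀ γ < κ.ord, ∀ f : Ordinal.{0} → Set Ordinal.{0},
    (∀ i < γ, f i ∈ U) → (Set.Iio κ.ord ∩ ⋂ i ∈ Set.Iio γ, f i) ∈ U

/-- `U` is nonprincipal: it contains no singleton. -/
def IsNonprincipal (U : Set (Set Ordinal.{0})) : Prop := ∀ x : Ordinal.{0}, {x} ∉ U

/-- `p = (s, T)` is a condition of the tree Prikry forcing on `κ` with
ultrafilter `U`: `s` is a finite strictly increasing sequence of ordinals below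
`κ`; `T` is a set of finite strictly increasing sequences of ordinals below `κ`,
closed under initial segments, whose every element is comparable with the stem
`s` (an initial segment of `s` or an end-extension of `s`), containing `s`, and
such that for every `t ∈ T` end-extending `s`, the set of one-point extensions
`Suc_T t = {β : t ++ [β] ∈ T}` belongs to `U`. -/
def TIsCond (κ : Cardinal.{0}) (U : Set (Set Ordinal.{0})) (p : TCond) : Prop :=
  (∀ x ∈ p.s, x < κ.ord) ∧ p.s.Chain' (· < ·) ∧
  p.s ∈ p.T ∧
  (∀ t ∈ p.T, (∀ x ∈ t, x < κ.ord) ∧ t.Chain' (· < ·)) ∧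
  (∀ t ∈ p.T, t <+: p.s ∨ p.s <+: t) ∧
  (∀ t u : List Ordinal.{0}, u ∈ p.T → t <+: u → t ∈ p.T) ∧
  (∀ t ∈ p.T, p.s <+: t → {β : Ordinal.{0} | t ++ [β] ∈ p.T} ∈ U)

/-- `p ≤ q`: `p` extends `q`, i.e. the stem of `p` end-extends the stem of `q`
and `T^p ⊆ T^q`. -/
def TExt (p q : TCond) : Prop := q.s <+: p.s ∧ p.T ⊆ q.T

/-- `p ≤* q`: `p` is a direct extension of `q`. -/
def TDirExt (p q : TCond) : Prop := TExt p q ∧ p.s = q.s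

/-- `D` is a dense open subset of the tree Prikry forcing. -/
def TDenseOpen (κ : Cardinal.{0}) (U : Set (Set Ordinal.{0})) (D : Set TCond) : Prop :=
  (∀ p ∈ D, TIsCond κ U p) ∧
  (∀ p, TIsCond κ U p → ∃ q ∈ D, TExt q p) ∧
  (∀ p ∈ D, ∀ q, TIsCond κ U q → TExt q p → q ∈ D)

/-- A filter on the tree Prikry poset: nonempty, upward closed among conditions,
any two elements have a common lower bound in it. -/
def TIsFilter (κ : Cardinal.{0}) (U : Set (Set Ordinal.{0})) (F : Set TCond) : Prop :=
  F.Nonempty ∧ (∀ p ∈ F, TIsCond κ U p) ∧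
  (∀ p ∈ F, ∀ q, TIsCond κ U q → TExt p q → q ∈ F) ∧
  (∀ p ∈ F, ∀ q ∈ F, ∃ r ∈ F, TExt r p ∧ TExt r q)

def TGood (κ : Cardinal.{0}) (U : Set (Set Ordinal.{0})) (D : Set TCond)
    (T : Set (List Ordinal.{0})) (t : List Ordinal.{0}) : Prop :=
  ∃ S : Set (List Ordinal.{0}), TIsCond κ U ⟨t, S⟩ ∧ S ⊆ T ∧
    ∀ F : Set TCond, TIsFilter κ U F → (⟨t, S⟩ : TCond) ∈ F →
      (∀ n : ℕ, ∃ r ∈ F, n < r.s.length) → ∃ r ∈ F, r ∈ D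

theorem tgood_step (κ : Cardinal.{0}) (U : Set (Set Ordinal.{0}))
    (hU : IsUltrafilterOn κ U) (D : Set TCond)
    (T : Set (List Ordinal.{0})) (t : List Ordinal.{0})
    (h : {β : Ordinal.{0} | TGood κ U D T (t ++ [β])} ∩ Set.Iio κ.ord ∈ U) :
    TGood κ U D T t := by
  obtain ⟨hU1, hU2, hU3, hU4, hU5, hU6⟩ := hU
  set B := {β : Ordinal.{0} | TGood κ U D T (t ++ [β])} ∩ Set.Iio κ.ord with hB
  have hBg : ∀ β ∈ B, TGood κ U D T (t ++ [β]) := fun β hb => hb.1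
  choose! S hSc hST hSF using hBg
  have hne : B.Nonempty := by
    rw [Set.nonempty_iff_ne_empty]; intro h0; rw [h0] at h; exact hU3 h
  obtain ⟨b0, hb0⟩ := hne
  have htS : ∀ β ∈ B, ∀ v, v <+: t → v ∈ S β := by
    intro β hβ v hv
    obtain ⟨c1, c2, c3, c4, c5, c6, c7⟩ := hSc β hβ
    exact c6 _ _ c3 (hv.trans (List.prefix_append t [β]))
  set R : Set (List Ordinal.{0}) := {v | ∃ β ∈ B, v ∈ S β} with hR
  -- an element of the tree properly longer than `t` lies above some `t ++ [β]`
  have key : ∀ β ∈ B, ∀ v ∈ S β, t.length < v.length → t ++ [β] <+: v := by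
    intro β hβ v hv hl
    obtain ⟨c1, c2, c3, c4, c5, c6, c7⟩ := hSc β hβ
    rcases c5 v hv with h1 | h1
    · have : v = t ++ [β] := h1.eq_of_length_le (by simp; omega)
      rw [this]
    · exact h1
  have hRT : ∀ v ∈ R, (∀ x ∈ v, x < κ.ord) ∧ v.IsChain (· < ·) := by
    rintro v ⟨β, hβ, hv⟩
    exact (hSc β hβ).2.2.2.1 v hv
  have htR : t ∈ R := ⟨b0, hb0, htS b0 hb0 t List.prefix_rfl⟩
  have hcond : TIsCond κ U ⟨t, R⟩ := by
    refine ⟨(hRT t htR).1, (hRT t htR).2, htR, hRT, ?_, ?_, ?_⟩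
    · rintro v ⟨β, hβ, hv⟩
      by_cases hl : t.length < v.length
      · exact Or.inr ((List.prefix_append t [β]).trans (key β hβ v hv hl))
      · left
        rcases (hSc β hβ).2.2.2.2.1 v hv with h1 | h1
        · exact List.prefix_of_prefix_length_le h1 (List.prefix_append t [β]) (not_lt.1 hl)
        · have := h1.length_le
          simp at this; omega
    · rintro v u ⟨β, hβ, hu⟩ hv
      exact ⟨β, hβ, (hSc β hβ).2.2.2.2.2.1 v u hu hv⟩
    · rintro v ⟨β, hβ, hv⟩ (htv : t <+: v)
      have hsub : {b : Ordinal.{0} | v ++ [b] ∈ R} ⊆ Set.Iio κ.ord := by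
        intro b hb
        exact (hRT _ hb).1 b (by simp)
      by_cases hl : t.length < v.length
      · exact hU4 _ _ ((hSc β hβ).2.2.2.2.2.2 v hv (key β hβ v hv hl))
          (fun b hb => ⟨β, hβ, hb⟩) hsub
      · have hvt : t = v := htv.eq_of_length_le (by omega)
        subst hvt
        exact hU4 _ _ h (fun b hb => ⟨b, hb, (hSc b hb).2.2.1⟩) hsub
  refine ⟨R, hcond, ?_, ?_⟩
  · rintro v ⟨β, hβ, hv⟩
    exact hST β hβ hv
  · intro F hF hFt hlen
    obtain ⟨r, hr, hrl⟩ := hlen t.length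
    obtain ⟨r', hr', he1, he2⟩ := hF.2.2.2 _ hFt r hr
    have hl' : t.length < r'.s.length := lt_of_lt_of_le hrl he2.1.length_le
    have hc' := hF.2.1 r' hr'
    obtain ⟨c1, c2, c3, c4, c5, c6, c7⟩ := hc'
    obtain ⟨β, hβ, hs⟩ := he1.2 c3
    have hk := key β hβ _ hs hl'
    refine hSF β hβ F hF (hF.2.2.1 r' hr' _ (hSc β hβ) ⟨hk, ?_⟩) hlen
    intro v hv
    rcases c5 v hv with h1 | h1
    · exact (hSc β hβ).2.2.2.2.2.1 _ _ hs h1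
    · obtain ⟨β', hβ', hv'⟩ := he1.2 hv
      have hk' := key β' hβ' v hv' (lt_of_lt_of_le hl' h1.length_le)
      have e : t ++ [β] = t ++ [β'] :=
        (List.prefix_of_prefix_length_le (hk.trans h1) hk' (by simp)).eq_of_length (by simp)
      have : β = β' := by simpa using e
      rw [this]; exact hv'

theorem tgood_root (κ : Cardinal.{0}) (U : Set (Set Ordinal.{0}))
    (hU : IsUltrafilterOn κ U) (D : Set TCond) (hD : TDenseOpen κ U D)
    (p : TCond) (hp : TIsCond κ U p) : TGood κ U D p.T p.s := by
  by_contra hbad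
  have hstep := tgood_step κ U hU D p.T
  obtain ⟨hU1, hU2, hU3, hU4, hU5, hU6⟩ := hU
  obtain ⟨c1, c2, c3, c4, c5, c6, c7⟩ := hp
  set S : Set (List Ordinal.{0}) :=
    {u | u ∈ p.T ∧ ∀ v, v <+: u → p.s <+: v → ¬ TGood κ U D p.T v} with hS
  have hcond : TIsCond κ U ⟨p.s, S⟩ := by
    refine ⟨c1, c2, ⟨c3, ?_⟩, fun t ht => c4 t ht.1, fun t ht => c5 t ht.1, ?_, ?_⟩
    · intro v h1 h2
      have : v = p.s := h1.eq_of_length_le h2.length_le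
      rw [this]; exact hbad
    · intro t u hu htu
      exact ⟨c6 t u hu.1 htu, fun v hv => hu.2 v (hv.trans htu)⟩
    · intro t ht (hpt : p.s <+: t)
      have hb : ¬ TGood κ U D p.T t := ht.2 t List.prefix_rfl hpt
      have hA : Set.Iio κ.ord \ ({β : Ordinal.{0} | TGood κ U D p.T (t ++ [β])} ∩ Set.Iio κ.ord)
          ∈ U := by
        rcases hU6 _ (Set.inter_subset_right :
          {β : Ordinal.{0} | TGood κ U D p.T (t ++ [β])} ∩ Set.Iio κ.ord ⊆ _) with h | h
        · exact absurd (hstep t h) hb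
        · exact h
      refine hU4 _ _ (hU5 _ _ hA (c7 t ht.1 hpt)) ?_ ?_
      · rintro β ⟨⟨hβ1, hβ2⟩, hβ3⟩
        refine ⟨hβ3, ?_⟩
        intro v hv hpv
        rcases List.prefix_concat_iff.1 hv with h | h
        · rw [h]; exact fun hg => hβ2 ⟨hg, hβ1⟩
        · exact ht.2 v h hpv
      · intro β hβ
        exact (c4 _ hβ.1).1 β (by simp)
  obtain ⟨q, hqD, hq1, hq2⟩ := hD.2.1 _ hcond
  have hqc := hD.1 q hqD
  have hqs := hq2 hqc.2.2.1
  exact hqs.2 q.s List.prefix_rfl hq1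
    ⟨q.T, hqc, fun v hv => (hq2 hv).1, fun F _ hqF _ => ⟨q, hqF, hqD⟩⟩

/-- the tree Prikry forcing on `κ`, with the length function
`l p = lh (s p)`, is κ-geometric. -/
theorem treePrikry_kappa_geometric (κ : Cardinal.{0}) (U : Set (Set Ordinal.{0}))
    (hκ : Cardinal.aleph0 < κ)
    (hU : IsUltrafilterOn κ U) (hcomp : IsKappaComplete κ U)
    (hnp : IsNonprincipal U) :
    ∀ γ < κ.ord, ∀ D : Ordinal.{0} → Set TCond,
      (∀ β < γ, TDenseOpen κ U (D β)) →
      ∀ p, TIsCond κ U p →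
        ∃ q, TIsCond κ U q ∧ TExt q p ∧
          ∀ F : Set TCond, TIsFilter κ U F → q ∈ F →
            (∀ n : ℕ, ∃ r ∈ F, n < r.s.length) →
            ∀ β < γ, ∃ r ∈ F, r ∈ D β := by
  intro γ hγ D hD p hp
  have hg : ∀ β < γ, TGood κ U (D β) p.T p.s :=
    fun β hβ => tgood_root κ U hU (D β) (hD β hβ) p hp
  choose! S hSc hST hSF using hg
  obtain ⟨hU1, hU2, hU3, hU4, hU5, hU6⟩ := hU
  obtain ⟨c1, c2, c3, c4, c5, c6, c7⟩ := hp
  have hcond : TIsCond κ U ⟨p.s, {v | v ∈ p.T ∧ ∀ β < γ, v ∈ S β}⟩ := by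
    refine ⟨c1, c2, ⟨c3, fun β hβ => (hSc β hβ).2.2.1⟩, fun t ht => c4 t ht.1,
      fun t ht => c5 t ht.1, ?_, ?_⟩
    · intro t u hu htu
      exact ⟨c6 t u hu.1 htu, fun β hβ => (hSc β hβ).2.2.2.2.2.1 t u (hu.2 β hβ) htu⟩
    · intro t ht hpt
      have h1 := hcomp γ hγ (fun β => {b : Ordinal.{0} | t ++ [b] ∈ S β})
        (fun β hβ => (hSc β hβ).2.2.2.2.2.2 t (ht.2 β hβ) hpt)
      refine hU4 _ _ (hU5 _ _ (c7 t ht.1 hpt) h1) ?_ ?_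
      · rintro b ⟨hb1, hb2, hb3⟩
        refine ⟨hb1, fun β hβ => ?_⟩
        simp only [Set.mem_iInter] at hb3
        exact hb3 β hβ
      · intro b hb
        exact (c4 _ hb.1).1 b (by simp)
  refine ⟨_, hcond, ⟨List.prefix_rfl, fun v hv => hv.1⟩, ?_⟩
  intro F hF hqF hlen β hβ
  exact hSF β hβ F hF
    (hF.2.2.1 _ hqF _ (hSc β hβ) ⟨List.prefix_rfl, fun v hv => hv.2 β hβ⟩) hlen
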